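/- (Dual feasibility pointwise bound, key step of Theorem 1.) Work in ℝ^n with the Euclidean inner product ⟨·,·⟩, a norm ‖·‖, and its dual norm ‖y‖_* = sup{⟨y,x⟩ : ‖x‖ ≤ 1}. Let C_ξ ∈ ℝ^{m×n}, d_ξ ∈ ℝ^m, a ∈ ℝ^n, b ∈ ℝ, ξ̂ ∈ ℝ^n, λ ≥ 0, and γ ∈ ℝ^m with γ ≥ 0 componentwise and ‖C_ξ^⊤ γ − a‖_* ≤ λ. Then for every ξ ∈ ℝ^n with C_ξ ξ ≤ d_ξ componentwise, ⟨a, ξ⟩ + b ≤ (b + ⟨a, ξ̂⟩ + ⟨γ, d_ξ − C_ξ ξ̂⟩) + λ ‖ξ − ξ̂‖. -/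

import Mathlib

open Matrix

/-- The dual norm `‖y‖_* = sup {⟨y,x⟩ : ‖x‖ ≤ 1}` of a norm `nrm` on `ℝ^n`. -/
noncomputable def dualNorm {n : ℕ} (nrm : (Fin n → ℝ) → ℝ) (y : Fin n → ℝ) : ℝ :=
  sSup {r : ℝ | ∃ x : Fin n → ℝ, nrm x ≤ 1 ∧ r = dotProduct y x}

/-- A linear functional on a finite-dimensional space is bounded by a multiple of any norm. -/
theorem LinearMap.exists_le_mul_norm_of_core {E : Type*} [AddCommGroup E] [Module ℝ E] [Norm E]
    [FiniteDimensional ℝ E] (core : NormedSpace.Core ℝ E) (f : E →ₗ[ℝ] ℝ) :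
    ∃ M : ℝ, 0 ≤ M ∧ ∀ x, f x ≤ M * ‖x‖ := by
  let _ : NormedAddCommGroup E := NormedAddCommGroup.ofCore core
  let _ : NormedSpace ℝ E := NormedSpace.ofCore core
  exact ⟨‖f.toContinuousLinearMap‖, norm_nonneg _, fun x =>
    (le_abs_self _).trans (f.toContinuousLinearMap.le_opNorm x)⟩

section DualNorm

variable {n : ℕ} {nrm : (Fin n → ℝ) → ℝ}

theorem nonneg_of_subadditive_of_abs_homogeneous
    (h_add : ∀ x y : Fin n → ℝ, nrm (x + y) ≤ nrm x + nrm y)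
    (h_smul : ∀ (r : ℝ) (x : Fin n → ℝ), nrm (r • x) = |r| * nrm x) (x : Fin n → ℝ) :
    0 ≤ nrm x := by
  have h0 : nrm 0 = 0 := by simpa using h_smul 0 0
  have hneg : nrm (-x) = nrm x := by simpa using h_smul (-1) x
  have h := h_add x (-x)
  rw [add_neg_cancel, h0, hneg] at h
  linarith

/-- The set whose supremum is the dual norm is bounded above. -/
theorem bddAbove_dotProduct_unitBall
    (h_add : ∀ x y : Fin n → ℝ, nrm (x + y) ≤ nrm x + nrm y)
    (h_smul : ∀ (r : ℝ) (x : Fin n → ℝ), nrm (r • x) = |r| * nrm x)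
    (h_eq_zero : ∀ x : Fin n → ℝ, nrm x = 0 ↔ x = 0) (y : Fin n → ℝ) :
    BddAbove {r : ℝ | ∃ x : Fin n → ℝ, nrm x ≤ 1 ∧ r = dotProduct y x} := by
  obtain ⟨M, hM, hle⟩ := @LinearMap.exists_le_mul_norm_of_core (Fin n → ℝ) _ _ ⟨nrm⟩ _
    (@NormedSpace.Core.mk ℝ (Fin n → ℝ) _ _ _ ⟨nrm⟩
      (@SeminormedSpace.Core.mk ℝ (Fin n → ℝ) _ _ ⟨nrm⟩ _
        (nonneg_of_subadditive_of_abs_homogeneous h_add h_smul) h_smul h_add)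
      h_eq_zero)
    (dotProductBilin ℝ ℝ y)
  refine ⟨M, ?_⟩
  rintro _ ⟨x, hx, rfl⟩
  exact (hle x).trans (mul_le_of_le_one_right hM hx)

/-- The Hölder inequality for a norm and its dual norm. -/
theorem dotProduct_le_dualNorm_mul
    (h_add : ∀ x y : Fin n → ℝ, nrm (x + y) ≤ nrm x + nrm y)
    (h_smul : ∀ (r : ℝ) (x : Fin n → ℝ), nrm (r • x) = |r| * nrm x)
    (h_eq_zero : ∀ x : Fin n → ℝ, nrm x = 0 ↔ x = 0) (y x : Fin n → ℝ) :
    dotProduct y x ≤ dualNorm nrm y * nrm x := by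
  rcases (nonneg_of_subadditive_of_abs_homogeneous h_add h_smul x).eq_or_lt with h | hpos
  · simp [(h_eq_zero x).1 h.symm, (h_eq_zero 0).2 rfl]
  · have hunit : nrm ((nrm x)⁻¹ • x) ≤ 1 := by
      rw [h_smul, abs_of_pos (inv_pos.2 hpos), inv_mul_cancel₀ hpos.ne']
    have h : dotProduct y ((nrm x)⁻¹ • x) ≤ dualNorm nrm y :=
      le_csSup (bddAbove_dotProduct_unitBall h_add h_smul h_eq_zero y) ⟨_, hunit, rfl⟩
    rwa [dotProduct_smul, smul_eq_mul, inv_mul_le_iff₀ hpos, mul_comm] at h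

end DualNorm

/-- **dual feasibility pointwise bound, key step of Theorem 1.**
Let `‖·‖` be a norm on `ℝ^n` with dual norm `‖·‖_*`. Let `C_ξ, d_ξ, a, b, ξ̂, λ ≥ 0`
and `γ ≥ 0` componentwise with `‖C_ξᵀ γ − a‖_* ≤ λ`. Then for every `ξ` with
`C_ξ ξ ≤ d_ξ` componentwise,
`⟨a, ξ⟩ + b ≤ (b + ⟨a, ξ̂⟩ + ⟨γ, d_ξ − C_ξ ξ̂⟩) + λ ‖ξ − ξ̂‖`. -/
theorem dual_feasibility_pointwise_bound
    {n m : ℕ} (nrm : (Fin n → ℝ) → ℝ)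
    (h_add : ∀ x y : Fin n → ℝ, nrm (x + y) ≤ nrm x + nrm y)
    (h_smul : ∀ (r : ℝ) (x : Fin n → ℝ), nrm (r • x) = |r| * nrm x)
    (h_eq_zero : ∀ x : Fin n → ℝ, nrm x = 0 ↔ x = 0)
    (Cξ : Matrix (Fin m) (Fin n) ℝ) (dξ : Fin m → ℝ)
    (a : Fin n → ℝ) (b : ℝ) (ξhat : Fin n → ℝ)
    (lam : ℝ) (hlam : 0 ≤ lam)
    (γ : Fin m → ℝ) (hγ : ∀ i, 0 ≤ γ i)
    (hdual : dualNorm nrm (Cξ.transpose.mulVec γ - a) ≤ lam) :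
    ∀ ξ : Fin n → ℝ, (∀ i, Cξ.mulVec ξ i ≤ dξ i) →
      dotProduct a ξ + b
        ≤ (b + dotProduct a ξhat
            + dotProduct γ (dξ - Cξ.mulVec ξhat))
          + lam * nrm (ξ - ξhat) := by
  intro ξ hξ
  have holder := dotProduct_le_dualNorm_mul h_add h_smul h_eq_zero
    (Cξ.transpose.mulVec γ - a) (ξhat - ξ)
  have hsymm : nrm (ξhat - ξ) = nrm (ξ - ξhat) := by
    simpa using h_smul (-1) (ξ - ξhat)
  have hle := mul_le_mul_of_nonneg_right hdual
    (nonneg_of_subadditive_of_abs_homogeneous h_add h_smul (ξ - ξhat))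
  have hfeas : dotProduct γ (Cξ.mulVec ξ) ≤ dotProduct γ dξ :=
    dotProduct_le_dotProduct_of_nonneg_left hξ hγ
  rw [hsymm, sub_dotProduct, dotProduct_sub, dotProduct_sub, mulVec_transpose,
    ← dotProduct_mulVec, ← dotProduct_mulVec] at holder
  rw [mulVec_transpose] at hle
  rw [dotProduct_sub]
  linarith
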